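/- Any accumulation point (x^∞, w^∞) of the sequence {(x^k, w^k)} generated by Algorithm iPALM solves the KKT system of (P), i.e., 0 ∈ ∂φ(w^∞) + ∇h(w^∞) + Ax^∞ and A*w^∞ = c. -/

import Mathlib

open scoped RealInnerProductSpace
open Filter Topology ContinuousLinearMap

/-- The set of subgradients (in the sense of convex analysis) of an
extended-real-valued function on a real inner product space. -/
def ESubdiff {W : Type*} [NormedAddCommGroup W] [InnerProductSpace ℝ W]
    (φ : W → EReal) (w : W) : Set W :=
  {d | ∀ u : W, φ w + ((⟪d, u - w⟫ : ℝ) : EReal) ≤ φ u}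

/-- Convexity of an extended-real-valued function. -/
def EConvex {W : Type*} [AddCommGroup W] [Module ℝ W] (φ : W → EReal) : Prop :=
  ∀ u v : W, ∀ a b : ℝ, 0 ≤ a → 0 ≤ b → a + b = 1 →
    φ (a • u + b • v) ≤ (a : EReal) * φ u + (b : EReal) * φ v

section Subgradients

variable {W : Type*} [NormedAddCommGroup W] [InnerProductSpace ℝ W]

lemma ne_top_of_mem_ESubdiff {φ : W → EReal} (htop : ∃ v, φ v ≠ ⊤)
    {w d : W} (hd : d ∈ ESubdiff φ w) : φ w ≠ ⊤ := by
  intro hw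
  obtain ⟨v, hv⟩ := htop
  have key := hd v
  rw [hw, EReal.top_add_coe] at key
  exact hv (top_le_iff.mp key)

lemma mem_ESubdiff_iff_of_eq_coe {φ : W → EReal} (hbot : ∀ v, φ v ≠ ⊥) {w d : W} {a : ℝ}
    (hw : φ w = a) :
    d ∈ ESubdiff φ w ↔ ∀ (u : W) (b : ℝ), φ u = b → a + ⟪d, u - w⟫ ≤ b := by
  constructor
  · intro hd u b hu
    have key := hd u
    rw [hw, hu] at key
    exact_mod_cast key
  · intro hd u
    by_cases hu : φ u = ⊤
    · rw [hu]
      exact le_top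
    · have hu' := (EReal.coe_toReal hu (hbot u)).symm
      rw [hw, hu']
      exact_mod_cast hd u _ hu'

/-- Subtracting the gradient of a quadratic perturbation from a subgradient of the perturbed
convex function gives a subgradient of the unperturbed one. -/
lemma sub_mem_ESubdiff_of_mem_add {φ : W → EReal} (hφ : EConvex φ) (hbot : ∀ v, φ v ≠ ⊥)
    (htop : ∃ v, φ v ≠ ⊤) {q B : W → ℝ} {w d g : W}
    (hq : ∀ (u : W) (t : ℝ), q (w + t • (u - w)) = q w + t * ⟪g, u - w⟫ + t ^ 2 * B u)
    (hd : d ∈ ESubdiff (fun v => φ v + (q v : EReal)) w) : d - g ∈ ESubdiff φ w := by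
  have hwtop : φ w ≠ ⊤ := by
    intro hw
    refine ne_top_of_mem_ESubdiff ?_ hd ?_
    · obtain ⟨v, hv⟩ := htop
      exact ⟨v, (EReal.add_lt_top hv (EReal.coe_ne_top _)).ne⟩
    · simp [hw]
  have hw := (EReal.coe_toReal hwtop (hbot w)).symm
  set a := (φ w).toReal
  refine (mem_ESubdiff_iff_of_eq_coe hbot hw).2 fun u b hu => ?_
  have hstep : ∀ t : ℝ, 0 < t → t ≤ 1 → a + ⟪d - g, u - w⟫ - b ≤ t * B u := by
    intro t ht0 ht1
    have hconv := hφ w u (1 - t) t (by linarith) ht0.le (by ring)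
    have hcomb : (1 - t) • w + t • u = w + t • (u - w) := by module
    rw [hcomb, hw, hu] at hconv
    have hsub := (hd (w + t • (u - w))).trans (add_le_add_left hconv _)
    simp only [hw] at hsub
    have hreal : a + q w + ⟪d, w + t • (u - w) - w⟫
        ≤ (1 - t) * a + t * b + q (w + t • (u - w)) := by exact_mod_cast hsub
    rw [hq, add_sub_cancel_left, inner_smul_right] at hreal
    rw [inner_sub_left]
    have : t * (a + (⟪d, u - w⟫ - ⟪g, u - w⟫) - b) ≤ t * (t * B u) := by nlinarith
    exact le_of_mul_le_mul_left this ht0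
  have hlim : Tendsto (fun t : ℝ => t * B u) (𝓝[>] 0) (𝓝 0) := by
    have : Tendsto (fun t : ℝ => t * B u) (𝓝 0) (𝓝 (0 * B u)) :=
      (continuous_id.mul continuous_const).tendsto 0
    rw [zero_mul] at this
    exact this.mono_left nhdsWithin_le_nhds
  have hle : a + ⟪d - g, u - w⟫ - b ≤ 0 := by
    refine ge_of_tendsto hlim ?_
    filter_upwards [Ioc_mem_nhdsGT (zero_lt_one' ℝ)] with t ht
    exact hstep t ht.1 ht.2
  linarith

lemma inner_sub_nonneg_of_mem_ESubdiff {φ : W → EReal} (hbot : ∀ v, φ v ≠ ⊥)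
    (htop : ∃ v, φ v ≠ ⊤) {u v p q : W} (hp : p ∈ ESubdiff φ u) (hq : q ∈ ESubdiff φ v) :
    0 ≤ ⟪p - q, u - v⟫ := by
  have hu := (EReal.coe_toReal (ne_top_of_mem_ESubdiff htop hp) (hbot u)).symm
  have hv := (EReal.coe_toReal (ne_top_of_mem_ESubdiff htop hq) (hbot v)).symm
  have h1 := (mem_ESubdiff_iff_of_eq_coe hbot hu).1 hp v _ hv
  have h2 := (mem_ESubdiff_iff_of_eq_coe hbot hv).1 hq u _ hu
  rw [← neg_sub u v, inner_neg_right] at h1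
  rw [inner_sub_left]
  linarith

/-- The graph of the subdifferential of a lower semicontinuous function is closed. -/
lemma mem_ESubdiff_of_tendsto {φ : W → EReal} (hlsc : LowerSemicontinuous φ)
    (hbot : ∀ v, φ v ≠ ⊥) {ι : Type*} {l : Filter ι} [l.NeBot] {w d : ι → W} {w₀ d₀ : W}
    (hw : Tendsto w l (𝓝 w₀)) (hd : Tendsto d l (𝓝 d₀)) (hmem : ∀ i, d i ∈ ESubdiff φ (w i)) :
    d₀ ∈ ESubdiff φ w₀ := by
  intro u
  by_cases hu : φ u = ⊤
  · rw [hu]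
    exact le_top
  have hu' := (EReal.coe_toReal hu (hbot u)).symm
  set b := (φ u).toReal
  have hbound : ∀ i, φ (w i) ≤ ((b - ⟪d i, u - w i⟫ : ℝ) : EReal) := by
    intro i
    have key := hmem i u
    rw [hu'] at key
    rw [EReal.coe_sub]
    exact EReal.le_sub_iff_add_le (.inl (EReal.coe_ne_bot _)) (.inl (EReal.coe_ne_top _)) |>.2 key
  have hlim : Tendsto (fun i => (w i, ((b - ⟪d i, u - w i⟫ : ℝ) : EReal))) l
      (𝓝 (w₀, ((b - ⟪d₀, u - w₀⟫ : ℝ) : EReal))) :=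
    hw.prodMk_nhds ((continuous_coe_real_ereal.tendsto _).comp
      ((hd.inner (hw.const_sub u)).const_sub b))
  have hfin : φ w₀ ≤ ((b - ⟪d₀, u - w₀⟫ : ℝ) : EReal) :=
    hlsc.isClosed_epigraph.mem_of_tendsto hlim (Eventually.of_forall hbound)
  rw [hu']
  rw [EReal.coe_sub] at hfin
  exact EReal.le_sub_iff_add_le (.inl (EReal.coe_ne_bot _)) (.inl (EReal.coe_ne_top _)) |>.1 hfin

end Subgradients

section Majorization

variable {W : Type*} [NormedAddCommGroup W] [InnerProductSpace ℝ W] [CompleteSpace W]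

lemma ConvexOn.add_inner_gradient_le {h : W → ℝ} (hconv : ConvexOn ℝ Set.univ h)
    (hdiff : Differentiable ℝ h) (u v : W) : h v + ⟪gradient h v, u - v⟫ ≤ h u := by
  have hline : ConvexOn ℝ Set.univ (h ∘ AffineMap.lineMap (k := ℝ) v u) := by
    simpa using hconv.comp_affineMap (AffineMap.lineMap (k := ℝ) v u)
  have hderiv : HasDerivAt (h ∘ AffineMap.lineMap (k := ℝ) v u) ⟪gradient h v, u - v⟫ 0 := by
    rw [inner_gradient_left]
    refine HasFDerivAt.comp_hasDerivAt (0 : ℝ) ?_ AffineMap.hasDerivAt_lineMap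
    simpa using (hdiff v).hasFDerivAt
  have := hline.le_slope_of_hasDerivAt (Set.mem_univ 0) (Set.mem_univ 1) zero_lt_one hderiv
  simp [slope_def_field, -inner_gradient_left] at this
  linarith

/-- A three-point inequality for the gradient of a convex function which is majorized by the
quadratic form of `Sig`. -/
lemma neg_quarter_le_inner_gradient_sub {h : W → ℝ} (hconv : ConvexOn ℝ Set.univ h)
    (hdiff : Differentiable ℝ h) {Sig : W →L[ℝ] W}
    (hmaj : ∀ u v : W, h u ≤ h v + ⟪gradient h v, u - v⟫ + (1 / 2) * ⟪Sig (u - v), u - v⟫)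
    (u v w : W) :
    -(1 / 4) * ⟪Sig (w - u), w - u⟫ ≤ ⟪gradient h u - gradient h v, w - v⟫ := by
  have hgrad := hconv.add_inner_gradient_le hdiff
  set p : W := (1 / 2 : ℝ) • (w - u) with hp
  have h1 := hmaj (u + p) u
  have h2 := hgrad (u + p) v
  have h3 := hmaj (v - p) v
  have h4 := hgrad (v - p) u
  have e2 : u + p - v = (w - v) - p := by rw [hp]; module
  have e4 : v - p - u = p - (w - v) := by rw [hp]; module
  have e3 : v - p - v = -p := by abel
  rw [add_sub_cancel_left] at h1
  rw [e2, inner_sub_right] at h2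
  rw [e3, map_neg, inner_neg_neg, inner_neg_right] at h3
  rw [e4, inner_sub_right] at h4
  have hquad : ⟪Sig p, p⟫ = (1 / 4) * ⟪Sig (w - u), w - u⟫ := by
    rw [hp, map_smul, inner_smul_left, inner_smul_right]
    simp
    ring
  rw [hquad] at h1 h3
  rw [inner_sub_left]
  linarith

end Majorization

/-- A positive definite quadratic form on a finite-dimensional space is coercive. -/
lemma exists_pos_mul_norm_sq_le_inner {W : Type*} [NormedAddCommGroup W] [InnerProductSpace ℝ W]
    [FiniteDimensional ℝ W] (T : W →L[ℝ] W) (hT : ∀ v : W, v ≠ 0 → 0 < ⟪T v, v⟫) :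
    ∃ m : ℝ, 0 < m ∧ ∀ v : W, m * ‖v‖ ^ 2 ≤ ⟪T v, v⟫ := by
  rcases subsingleton_or_nontrivial W with hW | hW
  · exact ⟨1, one_pos, fun v => by simp [Subsingleton.elim v 0]⟩
  obtain ⟨z, hz, hmin⟩ := (isCompact_sphere (0 : W) 1).exists_isMinOn
    (NormedSpace.sphere_nonempty.2 zero_le_one)
    (f := fun v => ⟪T v, v⟫) (by fun_prop)
  refine ⟨⟪T z, z⟫, hT z (ne_zero_of_mem_unit_sphere ⟨z, hz⟩), fun v => ?_⟩
  rcases eq_or_ne v 0 with rfl | hv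
  · simp
  have hn : 0 < ‖v‖ := norm_pos_iff.2 hv
  have key : ⟪T z, z⟫ ≤ ⟪T (‖v‖⁻¹ • v), ‖v‖⁻¹ • v⟫ :=
    hmin (by simp [norm_smul, hn.ne'])
  rw [map_smul, inner_smul_left, inner_smul_right] at key
  simp only [conj_trivial] at key
  calc ⟪T z, z⟫ * ‖v‖ ^ 2 ≤ ‖v‖⁻¹ * (‖v‖⁻¹ * ⟪T v, v⟫) * ‖v‖ ^ 2 := by gcongr
    _ = ⟪T v, v⟫ := by field_simp

/-- Quasi-Fejér type descent: if `E` decreases by `Q` up to a summable multiple of `n`, and `n` is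
controlled by the square root of the left-hand side, then `Q` tends to zero. -/
lemma tendsto_zero_of_quasi_descent {E Q n ε : ℕ → ℝ} {m : ℝ} (hE : ∀ k, 0 ≤ E k)
    (hQ : ∀ k, 0 ≤ Q k) (hε : ∀ k, 0 ≤ ε k) (hεsum : Summable ε) (hm : 0 < m)
    (hn : ∀ k, m * n k ^ 2 ≤ E (k + 1) + Q k)
    (hdesc : ∀ k, E (k + 1) + Q k ≤ E k + ε k * n k) : Tendsto Q atTop (𝓝 0) := by
  set C := √(m⁻¹) with hC
  set s : ℕ → ℝ := fun k => √(E (k + 1) + Q k)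
  have hs : ∀ k, s k ^ 2 = E (k + 1) + Q k := fun k => Real.sq_sqrt (add_nonneg (hE _) (hQ _))
  have hs0 : ∀ k, 0 ≤ s k := fun k => Real.sqrt_nonneg _
  have hns : ∀ k, n k ≤ C * s k := by
    intro k
    refine Real.le_sqrt_of_sq_le ?_ |>.trans_eq (Real.sqrt_mul (by positivity) _)
    rw [inv_mul_eq_div, le_div_iff₀ hm, mul_comm]
    exact hn k
  have hstep : ∀ k (r : ℝ), 0 ≤ r → E k ≤ r ^ 2 → s k ≤ r + C * ε k := by
    intro k r hr hEr
    have h1 : s k ^ 2 ≤ r ^ 2 + C * ε k * s k := by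
      rw [hs]
      have := mul_le_mul_of_nonneg_left (hns k) (hε k)
      linarith [hdesc k]
    have h2 : 0 ≤ C * ε k := mul_nonneg (Real.sqrt_nonneg _) (hε k)
    by_contra! hlt
    nlinarith [hs0 k]
  have hbound : ∀ k, s k ≤ √(E 0) + C * ∑ i ∈ Finset.range (k + 1), ε i := by
    intro k
    induction k with
    | zero =>
      simpa using hstep 0 _ (Real.sqrt_nonneg _) (Real.sq_sqrt (hE 0)).ge
    | succ k ih =>
      have := hstep (k + 1) (s k) (hs0 k) (by rw [hs]; linarith [hQ k])
      rw [Finset.sum_range_succ]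
      linarith
  set M := √(E 0) + C * ∑' i, ε i
  have hsM : ∀ k, s k ≤ M := fun k => (hbound k).trans <| by
    have := hεsum.sum_le_tsum (Finset.range (k + 1)) (fun i _ => hε i)
    have := mul_le_mul_of_nonneg_left this (Real.sqrt_nonneg m⁻¹)
    simp only [M, hC]
    linarith
  have hsum : ∀ k, ∑ i ∈ Finset.range k, Q i + E k ≤
      E 0 + ∑ i ∈ Finset.range k, ε i * (C * M) := by
    intro k
    induction k with
    | zero => simp
    | succ k ih =>
      rw [Finset.sum_range_succ, Finset.sum_range_succ]
      have h1 : n k ≤ C * M :=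
        (hns k).trans (mul_le_mul_of_nonneg_left (hsM k) (Real.sqrt_nonneg _))
      have := mul_le_mul_of_nonneg_left h1 (hε k)
      linarith [hdesc k]
  have hM : 0 ≤ C * M := mul_nonneg (Real.sqrt_nonneg _) ((hs0 0).trans (hsM 0))
  refine Summable.tendsto_atTop_zero <|
    summable_of_sum_range_le hQ (c := E 0 + ∑' i, ε i * (C * M)) fun k => ?_
  have := (hεsum.mul_right (C * M)).sum_le_tsum (Finset.range k)
    (fun i _ => mul_nonneg (hε i) hM)
  linarith [hsum k, hE k]

lemma IsSelfAdjoint.inner_sub_three_point {W : Type*} [NormedAddCommGroup W]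
    [InnerProductSpace ℝ W] [CompleteSpace W] {T : W →L[ℝ] W} (hT : IsSelfAdjoint T) (u v z : W) :
    ⟪T (u - z), u - z⟫ = ⟪T (v - z), v - z⟫ - 2 * ⟪T (v - u), v - z⟫ + ⟪T (v - u), v - u⟫ := by
  have hsymm : ⟪T (v - z), v - u⟫ = ⟪T (v - u), v - z⟫ := by
    rw [hT.isSymmetric.apply_clm (v - z) (v - u), real_inner_comm]
  have e : u - z = (v - z) - (v - u) := by abel
  rw [e, map_sub, inner_sub_left, inner_sub_right _ (v - z), inner_sub_right _ (v - z), hsymm]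
  ring

/-- Exact second-order expansion of the smooth part of the majorized augmented Lagrangian. -/
lemma majorized_lagrangian_expansion {X W : Type*} [NormedAddCommGroup X] [InnerProductSpace ℝ X]
    [CompleteSpace X] [NormedAddCommGroup W] [InnerProductSpace ℝ W] [CompleteSpace W]
    (A : X →L[ℝ] W) (c x : X) (σ r : ℝ) {Sig : W →L[ℝ] W} (hSig : IsSelfAdjoint Sig)
    (g w y u : W) (t : ℝ) :
    r + ⟪g, y + t • (u - y) - w⟫
        + (1 / 2) * ⟪Sig (y + t • (u - y) - w), y + t • (u - y) - w⟫
        + ⟪A.adjoint (y + t • (u - y)) - c, x⟫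
        + (σ / 2) * ‖A.adjoint (y + t • (u - y)) - c‖ ^ 2
      = (r + ⟪g, y - w⟫ + (1 / 2) * ⟪Sig (y - w), y - w⟫ + ⟪A.adjoint y - c, x⟫
        + (σ / 2) * ‖A.adjoint y - c‖ ^ 2)
        + t * ⟪g + Sig (y - w) + A x + σ • A (A.adjoint y - c), u - y⟫
        + t ^ 2 * ((1 / 2) * ⟪Sig (u - y), u - y⟫ + (σ / 2) * ‖A.adjoint (u - y)‖ ^ 2) := by
  have e1 : y + t • (u - y) - w = (y - w) + t • (u - y) := by abel
  have e2 : A.adjoint (y + t • (u - y)) - c = (A.adjoint y - c) + t • A.adjoint (u - y) := by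
    rw [map_add, map_smul]
    abel
  have hsymm : ⟪Sig (u - y), y - w⟫ = ⟪Sig (y - w), u - y⟫ := by
    rw [hSig.isSymmetric.apply_clm (u - y) (y - w), real_inner_comm]
  rw [e1, e2]
  generalize hD : u - y = D at *
  generalize hΔ : y - w = Δ at *
  generalize hR : A.adjoint y - c = R at *
  rw [norm_add_sq_real, norm_smul, mul_pow, Real.norm_eq_abs, sq_abs]
  simp only [map_add, map_smul, inner_add_left, inner_add_right, real_inner_smul_left,
    real_inner_smul_right, ← adjoint_inner_right A, hsymm]
  rw [real_inner_comm x (A.adjoint D)]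
  ring

/-- Any accumulation point `(x^∞, w^∞)` of the sequence `{(x^k, w^k)}`
generated by Algorithm iPALM solves the KKT system of (P), i.e.
`0 ∈ ∂φ(w^∞) + ∇h(w^∞) + A x^∞` and `A* w^∞ = c`. -/
theorem stmt_6
    {X W : Type*} [NormedAddCommGroup X] [InnerProductSpace ℝ X] [FiniteDimensional ℝ X]
    [NormedAddCommGroup W] [InnerProductSpace ℝ W] [FiniteDimensional ℝ W]
    -- `φ` is a closed proper convex function on `W`
    (φ : W → EReal) (hφconv : EConvex φ) (hφlsc : LowerSemicontinuous φ)
    (hφbot : ∀ v, φ v ≠ ⊥) (hφtop : ∃ v, φ v ≠ ⊤)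
    -- `h` is a convex continuously differentiable function on `W`
    (h : W → ℝ) (hhconv : ConvexOn ℝ Set.univ h) (hhdiff : ContDiff ℝ 1 h)
    -- problem data, penalty parameter and step-length
    (A : X →L[ℝ] W) (c : X) (σ τ : ℝ) (hσ : 0 < σ) (hτ0 : 0 < τ) (hτ2 : τ < 2)
    -- the majorization operator `Σ_h` (here `Sig`), self-adjoint positive semidefinite
    (Sig S : W →L[ℝ] W) (hSigsa : IsSelfAdjoint Sig) (hSigpsd : ∀ v : W, 0 ≤ ⟪Sig v, v⟫)
    (hmaj : ∀ u v : W, h u ≤ h v + ⟪gradient h v, u - v⟫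
      + (1 / 2) * ⟪Sig (u - v), u - v⟫)
    -- the proximal operator `S`: self-adjoint, `S ⪰ -(1/2)Σ_h`,
    -- and `(1/2)Σ_h + σAA* + S ≻ 0`
    (hSsa : IsSelfAdjoint S)
    (hS1 : ∀ v : W, -(1 / 2) * ⟪Sig v, v⟫ ≤ ⟪S v, v⟫)
    (hS2 : ∀ v : W, v ≠ 0 →
      0 < (1 / 2) * ⟪Sig v, v⟫ + σ * ‖A.adjoint v‖ ^ 2 + ⟪S v, v⟫)
    -- the KKT system has a solution
    (hKKT : ∃ (xs : X) (ws : W),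
      -(gradient h ws) - A xs ∈ ESubdiff φ ws ∧ A.adjoint ws = c)
    -- the iPALM iterates: errors, primal and dual sequences
    (ε : ℕ → ℝ) (hε : ∀ k, 0 ≤ ε k) (hεsum : Summable ε)
    (x : ℕ → X) (w : ℕ → W) (d : ℕ → W)
    (hd : ∀ k, ‖d k‖ ≤ ε k)
    -- `d^k ∈ ∂_w L_σ(w^{k+1}; (x^k, w^k)) + S(w^{k+1} - w^k)`
    (hsub : ∀ k : ℕ, d k - S (w (k + 1) - w k) ∈
      ESubdiff (fun v : W =>
        φ v + ((h (w k) + ⟪gradient h (w k), v - w k⟫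
          + (1 / 2) * ⟪Sig (v - w k), v - w k⟫
          + ⟪A.adjoint v - c, x k⟫
          + (σ / 2) * ‖A.adjoint v - c‖ ^ 2 : ℝ) : EReal)) (w (k + 1)))
    -- `x^{k+1} = x^k + τσ(A* w^{k+1} - c)`
    (hx : ∀ k : ℕ, x (k + 1) = x k + (τ * σ) • (A.adjoint (w (k + 1)) - c))
    (xinf : X) (winf : W)
    (hacc : ∃ ψ : ℕ → ℕ, StrictMono ψ ∧
      Tendsto (fun n => (x (ψ n), w (ψ n))) atTop (nhds (xinf, winf))) :
    -(gradient h winf) - A xinf ∈ ESubdiff φ winf ∧ A.adjoint winf = c := by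
  obtain ⟨xs, ws, hKs, hfeas⟩ := hKKT
  have hdiff : Differentiable ℝ h := hhdiff.differentiable one_ne_zero
  set G := gradient h with hG
  have hGcont : Continuous G :=
    (InnerProductSpace.toDual ℝ W).symm.continuous.comp (hhdiff.continuous_fderiv one_ne_zero)
  have hg : ∀ k, (d k - S (w (k + 1) - w k)) - (G (w k) + Sig (w (k + 1) - w k) + A (x k)
      + σ • A (A.adjoint (w (k + 1)) - c)) ∈ ESubdiff φ (w (k + 1)) := fun k =>
    sub_mem_ESubdiff_of_mem_add hφconv hφbot hφtop
      (fun u t => majorized_lagrangian_expansion A c (x k) σ _ hSigsa _ _ _ u t) (hsub k)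
  set E : ℕ → ℝ := fun k => (1 / 2) * (⟪S (w k - ws), w k - ws⟫ + ⟪Sig (w k - ws), w k - ws⟫)
    + 1 / (2 * (τ * σ)) * ‖x k - xs‖ ^ 2 with hEdef
  set P : ℕ → ℝ := fun k => (1 / 2) * (⟪S (w (k + 1) - w k), w (k + 1) - w k⟫
    + (1 / 2) * ⟪Sig (w (k + 1) - w k), w (k + 1) - w k⟫) with hPdef
  set R : ℕ → ℝ := fun k => (1 - τ / 2) * σ * ‖A.adjoint (w (k + 1)) - c‖ ^ 2 with hRdef
  have hτσ : 0 < τ * σ := mul_pos hτ0 hσ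
  have hE : ∀ k, 0 ≤ E k := fun k => by
    have h1 := hS1 (w k - ws)
    have h2 := hSigpsd (w k - ws)
    have h3 : 0 ≤ 1 / (2 * (τ * σ)) * ‖x k - xs‖ ^ 2 := by positivity
    simp only [hEdef]
    linarith
  have hP : ∀ k, 0 ≤ P k := fun k => by
    have := hS1 (w (k + 1) - w k)
    simp only [hPdef]
    linarith
  have hτ' : 0 < (1 - τ / 2) * σ := mul_pos (by linarith) hσ
  have hR : ∀ k, 0 ≤ R k := fun k => mul_nonneg hτ'.le (sq_nonneg _)
  obtain ⟨m, hm, hcoer⟩ : ∃ m : ℝ, 0 < m ∧ ∀ v : W, m * ‖v‖ ^ 2 ≤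
      (1 / 2) * ⟪Sig v, v⟫ + σ * ‖A.adjoint v‖ ^ 2 + ⟪S v, v⟫ := by
    have hT : ∀ v : W, ⟪((1 / 2 : ℝ) • Sig + σ • (A ∘L A.adjoint) + S) v, v⟫
        = (1 / 2) * ⟪Sig v, v⟫ + σ * ‖A.adjoint v‖ ^ 2 + ⟪S v, v⟫ := fun v => by
      simp only [add_apply, smul_apply,
        ContinuousLinearMap.comp_apply, inner_add_left, real_inner_smul_left]
      rw [← adjoint_inner_right A, real_inner_self_eq_norm_sq]
    obtain ⟨m, hm, hmT⟩ := exists_pos_mul_norm_sq_le_inner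
      ((1 / 2 : ℝ) • Sig + σ • (A ∘L A.adjoint) + S) (fun v hv => by
        rw [hT]
        exact hS2 v hv)
    exact ⟨m, hm, fun v => (hmT v).trans_eq (hT v)⟩
  have hres : ∀ k, A.adjoint (w k - ws) = A.adjoint (w k) - c := fun k => by
    rw [map_sub, hfeas]
  -- descent of the Lyapunov function
  have hdesc : ∀ k, E (k + 1) + (P k + R k) ≤ E k + ε k * ‖w (k + 1) - ws‖ := by
    intro k
    have hmono := inner_sub_nonneg_of_mem_ESubdiff hφbot hφtop (hg k) hKs
    have hthree := neg_quarter_le_inner_gradient_sub hhconv hdiff hmaj (w k) ws (w (k + 1))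
    have hdk : ⟪d k, w (k + 1) - ws⟫ ≤ ε k * ‖w (k + 1) - ws‖ :=
      (real_inner_le_norm _ _).trans (by gcongr; exact hd k)
    have hxk : ‖x (k + 1) - xs‖ ^ 2 = ‖x k - xs‖ ^ 2
        + 2 * (τ * σ) * ⟪x k - xs, A.adjoint (w (k + 1)) - c⟫
        + (τ * σ) ^ 2 * ‖A.adjoint (w (k + 1)) - c‖ ^ 2 := by
      rw [hx, add_sub_right_comm, norm_add_sq_real, norm_smul, mul_pow, Real.norm_eq_abs, sq_abs,
        real_inner_smul_right]
      ring
    have hmono' : 0 ≤ ⟪d k, w (k + 1) - ws⟫ - ⟪S (w (k + 1) - w k), w (k + 1) - ws⟫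
        - ⟪Sig (w (k + 1) - w k), w (k + 1) - ws⟫ - ⟪G (w k) - G ws, w (k + 1) - ws⟫
        - ⟪x k - xs, A.adjoint (w (k + 1)) - c⟫ - σ * ‖A.adjoint (w (k + 1)) - c‖ ^ 2 := by
      rw [← hres, ← real_inner_self_eq_norm_sq, adjoint_inner_right, adjoint_inner_right,
        ← real_inner_smul_left, hres]
      refine hmono.trans_eq ?_
      simp only [← inner_sub_left]
      congr 1
      rw [map_sub A (x k) xs]
      abel
    have hxE : 1 / (2 * (τ * σ)) * ‖x (k + 1) - xs‖ ^ 2 = 1 / (2 * (τ * σ)) * ‖x k - xs‖ ^ 2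
        + ⟪x k - xs, A.adjoint (w (k + 1)) - c⟫
        + τ / 2 * σ * ‖A.adjoint (w (k + 1)) - c‖ ^ 2 := by
      rw [hxk]
      field_simp
    have hS' := hSsa.inner_sub_three_point (w k) (w (k + 1)) ws
    have hSig' := hSigsa.inner_sub_three_point (w k) (w (k + 1)) ws
    simp only [hEdef, hPdef, hRdef]
    rw [hxE]
    linarith
  have hQ : Tendsto (fun k => P k + R k) atTop (𝓝 0) := by
    have hμ : 0 < min (1 / 2) (1 - τ / 2) := lt_min (by norm_num) (by linarith)
    refine tendsto_zero_of_quasi_descent (n := fun k => ‖w (k + 1) - ws‖)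
      (m := min (1 / 2) (1 - τ / 2) * m) hE (fun k => add_nonneg (hP k) (hR k)) hε hεsum
      (mul_pos hμ hm) (fun k => ?_) hdesc
    have h1 := mul_le_mul_of_nonneg_left (hcoer (w (k + 1) - ws)) hμ.le
    have h2 := hS1 (w (k + 1) - ws)
    have h3 := hSigpsd (w (k + 1) - ws)
    rw [hres] at h1
    have h4 : 0 ≤ 1 / (2 * (τ * σ)) * ‖x (k + 1) - xs‖ ^ 2 := by positivity
    have h5 := mul_le_mul_of_nonneg_right (min_le_left (1 / 2) (1 - τ / 2))
      (show 0 ≤ (1 / 2) * ⟪Sig (w (k + 1) - ws), w (k + 1) - ws⟫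
        + ⟪S (w (k + 1) - ws), w (k + 1) - ws⟫ by linarith)
    have h6 := mul_le_mul_of_nonneg_right (min_le_right (1 / 2) (1 - τ / 2))
      (show 0 ≤ σ * ‖A.adjoint (w (k + 1)) - c‖ ^ 2 by positivity)
    have h7 := hP k
    simp only [hEdef, hRdef]
    linarith
  have hPlim : Tendsto P atTop (𝓝 0) := squeeze_zero hP (fun k => by linarith [hR k]) hQ
  have hRlim : Tendsto R atTop (𝓝 0) := squeeze_zero hR (fun k => by linarith [hP k]) hQ
  have hreslim : Tendsto (fun k => A.adjoint (w (k + 1)) - c) atTop (𝓝 0) := by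
    rw [tendsto_zero_iff_norm_tendsto_zero]
    have h1 := (hRlim.const_mul ((1 - τ / 2) * σ)⁻¹).sqrt
    simp only [hRdef, inv_mul_cancel_left₀ hτ'.ne', Real.sqrt_sq (norm_nonneg _), mul_zero,
      Real.sqrt_zero] at h1
    exact h1
  have hreslim' : Tendsto (fun k => A.adjoint (w k) - c) atTop (𝓝 0) :=
    (tendsto_add_atTop_iff_nat 1).1 hreslim
  have hΔ : Tendsto (fun k => w (k + 1) - w k) atTop (𝓝 0) := by
    have hAΔ : Tendsto (fun k => A.adjoint (w (k + 1) - w k)) atTop (𝓝 0) := by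
      simpa using hreslim.sub hreslim'
    have hform : Tendsto (fun k => m⁻¹ * (2 * P k + σ * ‖A.adjoint (w (k + 1) - w k)‖ ^ 2))
        atTop (𝓝 0) := by
      simpa using ((hPlim.const_mul 2).add ((hAΔ.norm.pow 2).const_mul σ)).const_mul m⁻¹
    have hsq : Tendsto (fun k => ‖w (k + 1) - w k‖ ^ 2) atTop (𝓝 0) := by
      refine squeeze_zero (fun k => sq_nonneg _) (fun k => ?_) hform
      rw [inv_mul_eq_div, le_div_iff₀ hm, mul_comm]
      refine (hcoer _).trans_eq ?_
      simp only [hPdef]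
      ring
    rw [tendsto_zero_iff_norm_tendsto_zero]
    simpa [Real.sqrt_sq (norm_nonneg _)] using hsq.sqrt
  obtain ⟨ψ, hψ, hlim⟩ := hacc
  have hxlim : Tendsto (fun n => x (ψ n)) atTop (𝓝 xinf) := hlim.fst_nhds
  have hwlim : Tendsto (fun n => w (ψ n)) atTop (𝓝 winf) := hlim.snd_nhds
  have hψlim := hψ.tendsto_atTop
  have hΔψ := hΔ.comp hψlim
  have hwlim' : Tendsto (fun n => w (ψ n + 1)) atTop (𝓝 winf) := by
    simpa using hwlim.add hΔψ
  have hdlim : Tendsto d atTop (𝓝 0) := squeeze_zero_norm hd hεsum.tendsto_atTop_zero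
  refine ⟨?_, ?_⟩
  · refine mem_ESubdiff_of_tendsto hφlsc hφbot hwlim' ?_ (fun n => hg (ψ n))
    have hmap : ∀ T : W →L[ℝ] W, Tendsto (fun n => T (w (ψ n + 1) - w (ψ n))) atTop (𝓝 0) :=
      fun T => (T.continuous.tendsto' 0 0 (map_zero T)).comp hΔψ
    have hA1 := (A.continuous.tendsto xinf).comp hxlim
    have hA2 : Tendsto (fun n => σ • A (A.adjoint (w (ψ n + 1)) - c)) atTop (𝓝 0) := by
      simpa using ((A.continuous.tendsto 0).comp (hreslim.comp hψlim)).const_smul σ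
    have hall := ((hdlim.comp hψlim).sub (hmap S)).sub
      (((((hGcont.tendsto winf).comp hwlim).add (hmap Sig)).add hA1).add hA2)
    simpa only [sub_zero, zero_sub, add_zero, neg_add', Function.comp_apply] using hall
  · have h1 := ((A.adjoint.continuous.tendsto winf).comp hwlim).sub_const c
    exact sub_eq_zero.1 (tendsto_nhds_unique h1 (hreslim'.comp hψlim))
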